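/- arXiv:1510.08321 — 10 statements merged into one kernel-verified Lean document; each statement's English description precedes it below -/
import Mathlib

section
/- Let n ∈ ℕ, let A be a unital associative ℂ-algebra containing a magic unitary (p_{ij})_{i,j=1,…,n}, let ε : A → ℂ be a unital ℂ-algebra homomorphism with ε(p_{ij}) = δ_{ij}, let h be a complex Hilbert space, let ρ : A → B(h) be a unital ℂ-algebra homomorphism, and let η : A → h be a (ρ,ε)-cocycle. Then η(p_{ij}) = −ρ(p_{ij})(η(p_{ii})) for all i ≠ j. Consequently, if A is generated as a ℂ-algebra by the elements p_{ij}, then any two (ρ,ε)-cocycles (with respect to the same ρ and ε) that agree on p_{11}, …, p_{nn} are equal. -/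
/-- A `(ρ, ε)`-cocycle vanishes at `1`. -/
theorem cocycle_map_one {A H : Type*} [Ring A] [Algebra ℂ A]
    [NormedAddCommGroup H] [InnerProductSpace ℂ H]
    (ε : A →ₐ[ℂ] ℂ) (ρ : A →ₐ[ℂ] (H →L[ℂ] H)) (η : A →ₗ[ℂ] H)
    (hη : ∀ a b : A, η (a * b) = ρ a (η b) + ε b • η a) : η 1 = 0 := by
  simpa using hη 1 1

/-- Two `(ρ, ε)`-cocycles that agree on a generating set are equal. -/
theorem cocycle_ext_of_adjoin_eq_top {A H : Type*} [Ring A] [Algebra ℂ A]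
    [NormedAddCommGroup H] [InnerProductSpace ℂ H]
    (ε : A →ₐ[ℂ] ℂ) (ρ : A →ₐ[ℂ] (H →L[ℂ] H)) {η η' : A →ₗ[ℂ] H}
    (hη : ∀ a b : A, η (a * b) = ρ a (η b) + ε b • η a)
    (hη' : ∀ a b : A, η' (a * b) = ρ a (η' b) + ε b • η' a)
    {s : Set A} (hs : Algebra.adjoin ℂ s = ⊤) (h : Set.EqOn η' η s) : η' = η := by
  ext a
  have ha : a ∈ Algebra.adjoin ℂ s := hs ▸ Algebra.mem_top
  induction ha using Algebra.adjoin_induction with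
  | mem x hx => exact h hx
  | algebraMap r =>
    rw [Algebra.algebraMap_eq_smul_one, map_smul, map_smul, cocycle_map_one ε ρ η hη,
      cocycle_map_one ε ρ η' hη']
  | add x y _ _ hx hy => rw [map_add, map_add, hx, hy]
  | mul x y _ _ hx hy => rw [hη, hη', hx, hy]

/-- If `a * b = 0` and `ε b = 1`, a `(ρ, ε)`-cocycle satisfies `η a = - ρ a (η b)`. -/
theorem cocycle_eq_neg_of_mul_eq_zero {A H : Type*} [Ring A] [Algebra ℂ A]
    [NormedAddCommGroup H] [InnerProductSpace ℂ H]
    (ε : A →ₐ[ℂ] ℂ) (ρ : A →ₐ[ℂ] (H →L[ℂ] H)) (η : A →ₗ[ℂ] H)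
    (hη : ∀ a b : A, η (a * b) = ρ a (η b) + ε b • η a)
    {a b : A} (hab : a * b = 0) (hb : ε b = 1) : η a = - ρ a (η b) := by
  have h := hη a b
  rw [hab, map_zero, hb, one_smul] at h
  exact eq_neg_of_add_eq_zero_right h.symm

/-- For a magic unitary `p` in a unital ℂ-algebra `A`, a character `ε` with
`ε (p i j) = δ_{ij}`, a representation `ρ : A → B(h)` and a `(ρ,ε)`-cocycle `η`, one has
`η (p i j) = - ρ (p i j) (η (p i i))` for `i ≠ j`; consequently, if `A` is generated by the
`p i j`, a cocycle is determined by its values on the diagonal entries. -/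
theorem stmt_0 {n : ℕ} {A : Type*} [Ring A] [Algebra ℂ A]
    {H : Type*} [NormedAddCommGroup H] [InnerProductSpace ℂ H] [CompleteSpace H]
    (p : Fin n → Fin n → A)
    (hidem : ∀ i j, p i j * p i j = p i j)
    (hrow0 : ∀ i j k, j ≠ k → p i j * p i k = 0)
    (hcol0 : ∀ i j k, j ≠ k → p j i * p k i = 0)
    (hrow1 : ∀ i, ∑ j, p i j = 1)
    (hcol1 : ∀ i, ∑ j, p j i = 1)
    (ε : A →ₐ[ℂ] ℂ)
    (hε : ∀ i j, ε (p i j) = if i = j then 1 else 0)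
    (ρ : A →ₐ[ℂ] (H →L[ℂ] H))
    (η : A →ₗ[ℂ] H)
    (hη : ∀ a b : A, η (a * b) = ρ a (η b) + ε b • η a) :
    (∀ i j, i ≠ j → η (p i j) = - ρ (p i j) (η (p i i))) ∧
      (Algebra.adjoin ℂ {a : A | ∃ i j, a = p i j} = ⊤ →
        ∀ η' : A →ₗ[ℂ] H, (∀ a b : A, η' (a * b) = ρ a (η' b) + ε b • η' a) →
          (∀ i, η' (p i i) = η (p i i)) → η' = η) := by
  have offdiag : ∀ ξ : A →ₗ[ℂ] H, (∀ a b : A, ξ (a * b) = ρ a (ξ b) + ε b • ξ a) →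
      ∀ i j, i ≠ j → ξ (p i j) = - ρ (p i j) (ξ (p i i)) := fun ξ hξ i j hij =>
    cocycle_eq_neg_of_mul_eq_zero ε ρ ξ hξ (hrow0 i j i hij.symm) (by simp [hε])
  refine ⟨offdiag η hη, fun hgen η' hη' hdiag =>
    cocycle_ext_of_adjoin_eq_top ε ρ hη hη' hgen ?_⟩
  rintro _ ⟨i, j, rfl⟩
  by_cases hij : i = j
  · subst hij
    exact hdiag i
  · rw [offdiag η hη i j hij, offdiag η' hη' i j hij, hdiag]
end

section
/- Let n ∈ ℕ, let A be a unital ℂ-algebra generated as a ℂ-algebra by a magic unitary (p_{ij})_{i,j=1,…,n}, let ε : A → ℂ be a unital ℂ-algebra homomorphism with ε(p_{ij}) = δ_{ij}, let ρ : A → B(h) be a unital ℂ-algebra homomorphism into the bounded operators on a complex Hilbert space h, and let η : A → h be a (ρ,ε)-cocycle such that η(p_{11}) = η(p_{22}) = ⋯ = η(p_{nn}) =: ξ. Then η is a 1-coboundary: setting v = −ξ one has η(a) = ρ(a)v − ε(a)·v for every a ∈ A. -/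
/-- If `A` is generated by a magic unitary `p` and `η` is a `(ρ,ε)`-cocycle whose
values on all diagonal entries coincide (equal to `ξ`), then `η` is the 1-coboundary of
`v = -ξ`, i.e. `η a = ρ a v - ε a • v` for all `a`. -/
theorem stmt_2 {n : ℕ} {A : Type*} [Ring A] [Algebra ℂ A]
    {H : Type*} [NormedAddCommGroup H] [InnerProductSpace ℂ H] [CompleteSpace H]
    (p : Fin n → Fin n → A)
    (hidem : ∀ i j, p i j * p i j = p i j)
    (hrow0 : ∀ i j k, j ≠ k → p i j * p i k = 0)
    (hcol0 : ∀ i j k, j ≠ k → p j i * p k i = 0)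
    (hrow1 : ∀ i, ∑ j, p i j = 1)
    (hcol1 : ∀ i, ∑ j, p j i = 1)
    (hgen : Algebra.adjoin ℂ {a : A | ∃ i j, a = p i j} = ⊤)
    (ε : A →ₐ[ℂ] ℂ)
    (hε : ∀ i j, ε (p i j) = if i = j then 1 else 0)
    (ρ : A →ₐ[ℂ] (H →L[ℂ] H))
    (η : A →ₗ[ℂ] H)
    (hη : ∀ a b : A, η (a * b) = ρ a (η b) + ε b • η a)
    (ξ : H)
    (hdiag : ∀ i, η (p i i) = ξ) :
    ∀ a : A, η a = ρ a (-ξ) - ε a • (-ξ) := by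
  have hη1 : η 1 = 0 := by simpa using hη 1 1
  have hdiag0 : ∀ i, ρ (p i i) ξ = 0 := fun i => by
    simpa [hidem, hε, hdiag] using hη (p i i) (p i i)
  intro a
  have ha : a ∈ Algebra.adjoin ℂ {a : A | ∃ i j, a = p i j} := hgen ▸ Algebra.mem_top
  induction ha using Algebra.adjoin_induction with
  | mem x hx =>
    obtain ⟨i, j, rfl⟩ := hx
    by_cases hij : i = j
    · subst hij
      simp [hdiag, hdiag0, hε]
    · have h := hη (p i j) (p j j)
      rw [hcol0 j i j hij, map_zero, hdiag, hε, if_pos rfl, one_smul] at h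
      rw [hε, if_neg hij, zero_smul, sub_zero, map_neg]
      exact (neg_eq_of_add_eq_zero_right h.symm).symm
  | algebraMap r => simp [Algebra.algebraMap_eq_smul_one, hη1]
  | add x y _ _ hx hy =>
    rw [map_add, hx, hy, map_add, map_add, add_apply, add_smul]
    abel
  | mul x y _ _ hx hy =>
    rw [hη, hx, hy, map_mul, map_mul, mul_apply_eq_comp, map_sub, map_smul,
      smul_sub, smul_smul, mul_comm (ε y)]
    abel
end

section
/- Let n ∈ ℕ, let A be a unital ℂ-algebra generated as a ℂ-algebra by a magic unitary (p_{ij})_{i,j=1,…,n}, and let ε : A → ℂ be a unital ℂ-algebra homomorphism with ε(p_{ij}) = δ_{ij}. Then every Gaussian cocycle on A vanishes: if V is a complex vector space and η : A → V is a ℂ-linear map satisfying η(ab) = ε(a)η(b) + ε(b)η(a) for all a,b ∈ A, then η = 0. (In particular, quantum permutation groups admit no nonzero Gaussian Lévy processes.) -/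
/-- A map satisfying the Leibniz rule relative to a character vanishes on idempotents. -/
theorem leibniz_eq_zero_of_isIdempotentElem {K A V : Type*} [Field K] [Ring A] [Algebra K A]
    [AddCommGroup V] [Module K V] (ε : A →ₐ[K] K) (η : A →ₗ[K] V)
    (hη : ∀ a b : A, η (a * b) = ε a • η b + ε b • η a) {e : A} (he : IsIdempotentElem e) :
    η e = 0 := by
  have h := hη e e
  rw [he.eq] at h
  rcases IsIdempotentElem.iff_eq_zero_or_one.mp (he.map ε) with h0 | h1
  · simpa [h0] using h
  · simpa [h1] using h


/-- If `A` is generated by a magic unitary `p` and `ε` is a character with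
`ε (p i j) = δ_{ij}`, then every Gaussian cocycle `η : A → V` (satisfying the Leibniz rule
`η (a b) = ε a • η b + ε b • η a`) vanishes. -/
theorem stmt_3 {n : ℕ} {A : Type*} [Ring A] [Algebra ℂ A]
    {V : Type*} [AddCommGroup V] [Module ℂ V]
    (p : Fin n → Fin n → A)
    (hidem : ∀ i j, p i j * p i j = p i j)
    (hrow0 : ∀ i j k, j ≠ k → p i j * p i k = 0)
    (hcol0 : ∀ i j k, j ≠ k → p j i * p k i = 0)
    (hrow1 : ∀ i, ∑ j, p i j = 1)
    (hcol1 : ∀ i, ∑ j, p j i = 1)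
    (hgen : Algebra.adjoin ℂ {a : A | ∃ i j, a = p i j} = ⊤)
    (ε : A →ₐ[ℂ] ℂ)
    (hε : ∀ i j, ε (p i j) = if i = j then 1 else 0)
    (η : A →ₗ[ℂ] V)
    (hη : ∀ a b : A, η (a * b) = ε a • η b + ε b • η a) :
    η = 0 := by
  have hgen0 : ∀ i j, η (p i j) = 0 := fun i j =>
    leibniz_eq_zero_of_isIdempotentElem ε η hη (hidem i j)
  ext a
  have ha : a ∈ Algebra.adjoin ℂ {a : A | ∃ i j, a = p i j} := hgen ▸ Algebra.mem_top
  rw [LinearMap.zero_apply]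
  induction ha using Algebra.adjoin_induction with
  | mem x hx =>
    obtain ⟨i, j, rfl⟩ := hx
    exact hgen0 i j
  | algebraMap r =>
    rw [Algebra.algebraMap_eq_smul_one, map_smul,
      leibniz_eq_zero_of_isIdempotentElem ε η hη IsIdempotentElem.one, smul_zero]
  | add x y _ _ hx hy => rw [map_add, hx, hy, add_zero]
  | mul x y _ _ hx hy => rw [hη, hx, hy, smul_zero, smul_zero, add_zero]
end

section
/- Let n ∈ ℕ and let σ be a permutation of {1,…,n} with σ ≠ id. Define the ℂ-subspace Z_σ = {ξ ∈ ℂⁿ : ξ_i = 0 whenever σ(i) = i, and ξ_i = ξ_j whenever i and j lie in the same cycle of σ (i.e. σ^k(i) = j for some integer k)}, and let b ∈ ℂⁿ be the indicator vector of the support of σ (b_i = 1 if σ(i) ≠ i and b_i = 0 otherwise). Then b is a nonzero element of Z_σ, dim_ℂ Z_σ = cyc(σ) − fix(σ), and dim_ℂ (Z_σ / ℂ·b) = cyc(σ) − fix(σ) − 1, where cyc(σ) is the number of cycles (orbits) of σ and fix(σ) the number of its fixed points, so that cyc(σ) − fix(σ) equals the number of cycles of σ of length at least 2. -/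
namespace Equiv.Perm

variable {α : Type*} [Fintype α] [DecidableEq α]

/-- The function on `α` that is constant on each nontrivial cycle `c` of `σ`, with value `f c`,
and vanishes on the fixed points of `σ`. -/
def extendCycleFactors (K : Type*) [Semiring K] (σ : Perm α) :
    (σ.cycleFactorsFinset → K) →ₗ[K] (α → K) where
  toFun f i :=
    if h : i ∈ σ.support then f ⟨σ.cycleOf i, cycleOf_mem_cycleFactorsFinset_iff.2 h⟩ else 0
  map_add' f g := by
    ext i
    by_cases h : i ∈ σ.support <;> simp [h, -mem_support]
  map_smul' c f := by
    ext i
    by_cases h : i ∈ σ.support <;> simp [h, -mem_support]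

variable {K : Type*} [Semiring K] {σ : Perm α}

theorem extendCycleFactors_of_mem_support (f : σ.cycleFactorsFinset → K) {i : α}
    (h : i ∈ σ.support) :
    extendCycleFactors K σ f i = f ⟨σ.cycleOf i, cycleOf_mem_cycleFactorsFinset_iff.2 h⟩ :=
  dif_pos h

theorem extendCycleFactors_of_notMem_support (f : σ.cycleFactorsFinset → K) {i : α}
    (h : i ∉ σ.support) : extendCycleFactors K σ f i = 0 :=
  dif_neg h

theorem exists_cycleOf_eq_of_mem_cycleFactorsFinset {c : Perm α}
    (hc : c ∈ σ.cycleFactorsFinset) : ∃ i ∈ σ.support, σ.cycleOf i = c := by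
  obtain ⟨i, hi⟩ := (mem_cycleFactorsFinset_iff.1 hc).1.nonempty_support
  exact ⟨i, mem_cycleFactorsFinset_support_le hc hi, (cycle_is_cycleOf hi hc).symm⟩

theorem extendCycleFactors_injective : Function.Injective (extendCycleFactors K σ) := by
  intro f g hfg
  ext ⟨c, hc⟩
  obtain ⟨i, hi, rfl⟩ := exists_cycleOf_eq_of_mem_cycleFactorsFinset hc
  simpa only [extendCycleFactors_of_mem_support _ hi] using congrFun hfg i

theorem mem_range_extendCycleFactors_iff {ξ : α → K} :
    ξ ∈ LinearMap.range (extendCycleFactors K σ) ↔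
      (∀ i, σ i = i → ξ i = 0) ∧ ∀ i j, σ.SameCycle i j → ξ i = ξ j := by
  constructor
  · rintro ⟨f, rfl⟩
    refine ⟨fun i hi ↦ extendCycleFactors_of_notMem_support f (notMem_support.2 hi),
      fun i j hij ↦ ?_⟩
    by_cases hi : i ∈ σ.support
    · have hj : j ∈ σ.support := mem_support.2 (hij.apply_eq_self_iff.not.1 (mem_support.1 hi))
      simp only [extendCycleFactors_of_mem_support f hi, extendCycleFactors_of_mem_support f hj,
        hij.cycleOf_eq]
    · have hj : j ∉ σ.support :=
        notMem_support.2 (hij.apply_eq_self_iff.1 (notMem_support.1 hi))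
      rw [extendCycleFactors_of_notMem_support f hi, extendCycleFactors_of_notMem_support f hj]
  · rintro ⟨hfix, hcycle⟩
    choose r hr hrc using fun c : σ.cycleFactorsFinset ↦
      exists_cycleOf_eq_of_mem_cycleFactorsFinset c.2
    refine ⟨fun c ↦ ξ (r c), ?_⟩
    ext i
    by_cases hi : i ∈ σ.support
    · rw [extendCycleFactors_of_mem_support _ hi]
      exact hcycle _ _ ((sameCycle_iff_cycleOf_eq_of_mem_support (hr _) hi).2 (hrc _))
    · rw [extendCycleFactors_of_notMem_support _ hi, hfix i (notMem_support.1 hi)]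

theorem finrank_range_extendCycleFactors [StrongRankCondition K] :
    Module.finrank K (LinearMap.range (extendCycleFactors K σ)) =
      Multiset.card σ.cycleType := by
  rw [LinearMap.finrank_range_of_inj extendCycleFactors_injective,
    Module.finrank_fintype_fun_eq_card, Fintype.card_coe, cycleType_def, Multiset.card_map, Finset.card_def]

end Equiv.Perm

theorem Submodule.finrank_quotient_comap_span_singleton {K V : Type*} [DivisionRing K]
    [AddCommGroup V] [Module K V] (Z : Submodule K V) [FiniteDimensional K Z] {b : V}
    (hbZ : b ∈ Z) (hb : b ≠ 0) :
    Module.finrank K (↥Z ⧸ (Submodule.span K {b}).comap Z.subtype) = Module.finrank K Z - 1 := by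
  have hspan : (Submodule.span K {b}).comap Z.subtype = Submodule.span K {(⟨b, hbZ⟩ : Z)} := by
    ext x
    simp [Submodule.mem_span_singleton, Subtype.ext_iff]
  rw [hspan, Submodule.finrank_quotient, finrank_span_singleton (by simpa using hb)]


/-- For a nontrivial permutation `σ` of `{1,…,n}`, the space
`Z_σ = {ξ ∈ ℂⁿ : ξ_i = 0 on fixed points, ξ constant on cycles}` contains the (nonzero)
indicator vector `b` of the support of `σ`, has dimension `cyc(σ) - fix(σ)` (the number of
cycles of length at least 2, i.e. the cardinality of the cycle type), and
`dim (Z_σ / ℂ·b) = cyc(σ) - fix(σ) - 1`. -/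
theorem stmt_4 {n : ℕ} (σ : Equiv.Perm (Fin n)) (hσ : σ ≠ 1)
    (Z : Submodule ℂ (Fin n → ℂ))
    (hZ : ∀ ξ : Fin n → ℂ, ξ ∈ Z ↔
      ((∀ i, σ i = i → ξ i = 0) ∧ ∀ i j, σ.SameCycle i j → ξ i = ξ j))
    (b : Fin n → ℂ)
    (hb : ∀ i, b i = if σ i = i then 0 else 1) :
    b ∈ Z ∧ b ≠ 0 ∧
      Module.finrank ℂ Z = Multiset.card σ.cycleType ∧
      Module.finrank ℂ (↥Z ⧸ (Submodule.span ℂ {b}).comap Z.subtype) =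
        Multiset.card σ.cycleType - 1 := by
  have hbZ : b ∈ Z := by
    refine (hZ b).2 ⟨fun i hi ↦ by simp [hb, hi], fun i j hij ↦ ?_⟩
    simp only [hb, hij.apply_eq_self_iff]
  have hb0 : b ≠ 0 := by
    rintro rfl
    exact hσ (Equiv.ext fun i ↦ by simpa using hb i)
  have hrange : Z = LinearMap.range (σ.extendCycleFactors ℂ) :=
    Submodule.ext fun ξ ↦ (hZ ξ).trans Equiv.Perm.mem_range_extendCycleFactors_iff.symm
  have hrank : Module.finrank ℂ Z = Multiset.card σ.cycleType := by
    rw [hrange, Equiv.Perm.finrank_range_extendCycleFactors]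
  exact ⟨hbZ, hb0, hrank, by rw [Z.finrank_quotient_comap_span_singleton hbZ hb0, hrank]⟩
end

section
/- Let A be a bialgebra over ℂ with comultiplication Δ and counit ε, and let L : A → ℂ be a ℂ-linear functional. Define the convolution powers L^{⋆0} = ε and L^{⋆(n+1)} = m_ℂ ∘ (L ⊗ L^{⋆n}) ∘ Δ (where m_ℂ is multiplication of complex numbers), and suppose that for every a ∈ A and every t ≥ 0 the series ω_t(a) = ∑_{n=0}^∞ (tⁿ/n!) L^{⋆n}(a) converges absolutely. Then every functional ω_t (t ≥ 0) is tracial (ω_t(ab) = ω_t(ba) for all a,b ∈ A) if and only if L is tracial (L(ab) = L(ba) for all a,b ∈ A). -/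
/-- If a power series converges absolutely at `1` and vanishes on `[0, 1]`, then its linear
coefficient is zero. -/
theorem coeff_one_eq_zero_of_tsum_eq_zero {d : ℕ → ℂ} (hd : Summable fun m => ‖d m‖)
    (h : ∀ t : ℝ, 0 ≤ t → t ≤ 1 → ∑' m, (t : ℂ) ^ m * d m = 0) : d 1 = 0 := by
  have h0 : d 0 = 0 := by
    have h' := h 0 le_rfl zero_le_one
    rwa [tsum_eq_single 0 (fun m hm => by simp [hm]), pow_zero, one_mul] at h'
  have hd2 : Summable fun m => ‖d (m + 2)‖ :=
    (summable_nat_add_iff (f := fun m => ‖d m‖) 2).2 hd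
  have key : ∀ t : ℝ, 0 < t → t ≤ 1 → ‖d 1‖ ≤ t * ∑' m, ‖d (m + 2)‖ := by
    intro t ht ht1
    have hs : Summable fun m => (t : ℂ) ^ m * d m := by
      refine Summable.of_norm_bounded hd fun m => ?_
      rw [norm_mul, norm_pow, Complex.norm_of_nonneg ht.le]
      exact mul_le_of_le_one_left (norm_nonneg _) (pow_le_one₀ ht.le ht1)
    have hsplit := hs.sum_add_tsum_nat_add 2
    rw [h t ht.le ht1, Finset.sum_range_succ, Finset.sum_range_one, h0, mul_zero, zero_add,
      pow_one] at hsplit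
    have hbound : ‖∑' m, (t : ℂ) ^ (m + 2) * d (m + 2)‖ ≤ ∑' m, t ^ 2 * ‖d (m + 2)‖ := by
      refine tsum_of_norm_bounded (hd2.mul_left (t ^ 2)).hasSum fun m => ?_
      rw [norm_mul, norm_pow, Complex.norm_of_nonneg ht.le]
      exact mul_le_mul_of_nonneg_right (pow_le_pow_of_le_one ht.le ht1 (by omega))
        (norm_nonneg _)
    rw [tsum_mul_left, ← norm_neg, ← eq_neg_of_add_eq_zero_left hsplit, norm_mul,
      Complex.norm_of_nonneg ht.le, pow_two, mul_assoc] at hbound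
    exact le_of_mul_le_mul_left hbound ht
  have hlim : Filter.Tendsto (fun t : ℝ => t * ∑' m, ‖d (m + 2)‖)
      (nhdsWithin 0 (Set.Ioi 0)) (nhds 0) :=
    tendsto_nhdsWithin_of_tendsto_nhds
      ((continuous_id.mul continuous_const).tendsto' _ _ (zero_mul _))
  have hle : ‖d 1‖ ≤ 0 := by
    refine ge_of_tendsto hlim ?_
    filter_upwards [Ioc_mem_nhdsGT (zero_lt_one' ℝ)] with t ht using key t ht.1 ht.2
  exact norm_le_zero_iff.1 hle

/-- The product of two tracial functionals is tracial on the tensor product. -/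
theorem mul'_map_mul_comm {R A B : Type*} [CommSemiring R] [Semiring A] [Algebra R A]
    [Semiring B] [Algebra R B] {f : A →ₗ[R] R} {g : B →ₗ[R] R}
    (hf : ∀ a b, f (a * b) = f (b * a)) (hg : ∀ a b, g (a * b) = g (b * a))
    (x y : TensorProduct R A B) :
    LinearMap.mul' R R (TensorProduct.map f g (x * y)) =
      LinearMap.mul' R R (TensorProduct.map f g (y * x)) := by
  induction x with
  | zero => simp
  | add x₁ x₂ h₁ h₂ => simp only [add_mul, mul_add, map_add, h₁, h₂]
  | tmul a b =>
    induction y with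
    | zero => simp
    | add y₁ y₂ h₁ h₂ => simp only [add_mul, mul_add, map_add, h₁, h₂]
    | tmul c d => simp [hf a c, hg b d]

/-- The convolution of two tracial functionals on a bialgebra is tracial. -/
theorem convolution_mul_comm {R A : Type*} [CommSemiring R] [Semiring A] [Bialgebra R A]
    {f g : A →ₗ[R] R}
    (hf : ∀ a b, f (a * b) = f (b * a)) (hg : ∀ a b, g (a * b) = g (b * a)) (a b : A) :
    (LinearMap.mul' R R ∘ₗ TensorProduct.map f g ∘ₗ Coalgebra.comul) (a * b) =
      (LinearMap.mul' R R ∘ₗ TensorProduct.map f g ∘ₗ Coalgebra.comul) (b * a) := by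
  simp only [LinearMap.comp_apply, Bialgebra.comul_mul]
  exact mul'_map_mul_comm hf hg _ _

/-- The counit is a right unit for convolution. -/
theorem convolution_counit {R A : Type*} [CommSemiring R] [AddCommMonoid A] [Module R A]
    [Coalgebra R A] (f : A →ₗ[R] R) :
    LinearMap.mul' R R ∘ₗ TensorProduct.map f Coalgebra.counit ∘ₗ Coalgebra.comul = f := by
  ext a
  have h : TensorProduct.map f (Coalgebra.counit (R := R) (A := A)) =
      f.rTensor R ∘ₗ Coalgebra.counit.lTensor A := by
    rw [LinearMap.rTensor_comp_lTensor]
  rw [h, LinearMap.comp_apply, LinearMap.comp_apply, LinearMap.comp_apply,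
    Coalgebra.lTensor_counit_comul, LinearMap.rTensor_tmul, LinearMap.mul'_apply, mul_one]


/-- For a linear functional `L` on a ℂ-bialgebra `A` with convolution powers
`Lpow m` (so `Lpow 0 = ε` and `Lpow (m+1) = L ⋆ Lpow m`), assuming absolute convergence of the
exponential series `ω_t(a) = ∑ tᵐ/m! Lpow m (a)` for all `t ≥ 0`, all the functionals `ω_t`
are tracial if and only if `L` is tracial. -/
theorem stmt_11 {A : Type*} [Semiring A] [Bialgebra ℂ A]
    (L : A →ₗ[ℂ] ℂ)
    (Lpow : ℕ → (A →ₗ[ℂ] ℂ))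
    (hL0 : Lpow 0 = Coalgebra.counit)
    (hLsucc : ∀ m : ℕ, Lpow (m + 1) =
      LinearMap.mul' ℂ ℂ ∘ₗ TensorProduct.map L (Lpow m) ∘ₗ Coalgebra.comul)
    (hsummable : ∀ (t : ℝ), 0 ≤ t → ∀ a : A,
      Summable fun m : ℕ => ‖((t : ℂ) ^ m / (m.factorial : ℂ)) * Lpow m a‖) :
    (∀ (t : ℝ), 0 ≤ t → ∀ a b : A,
        (∑' m : ℕ, ((t : ℂ) ^ m / (m.factorial : ℂ)) * Lpow m (a * b)) =
          (∑' m : ℕ, ((t : ℂ) ^ m / (m.factorial : ℂ)) * Lpow m (b * a))) ↔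
      (∀ a b : A, L (a * b) = L (b * a)) := by
 
  constructor
  · intro h a b
    have hL1 : Lpow 1 = L := by rw [hLsucc 0, hL0, convolution_counit]
    have hs (t : ℝ) (ht : 0 ≤ t) (a : A) := (hsummable t ht a).of_norm
    have hsub : ∀ m : ℕ, ∀ t : ℂ,
        t ^ m * ((Lpow m (a * b) - Lpow m (b * a)) / (m.factorial : ℂ)) =
          t ^ m / (m.factorial : ℂ) * Lpow m (a * b) -
            t ^ m / (m.factorial : ℂ) * Lpow m (b * a) := fun m t => by ring
    have hd : Summable fun m : ℕ =>
        ‖(Lpow m (a * b) - Lpow m (b * a)) / (m.factorial : ℂ)‖ := by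
      refine (((hs 1 zero_le_one (a * b)).sub (hs 1 zero_le_one (b * a))).norm).congr fun m => ?_
      rw [← hsub, Complex.ofReal_one, one_pow, one_mul]
    have h1 := coeff_one_eq_zero_of_tsum_eq_zero hd fun t ht _ => by
      simp only [hsub]
      rw [(hs t ht (a * b)).tsum_sub (hs t ht (b * a)), h t ht a b, sub_self]
    simpa [hL1, sub_eq_zero] using h1
  · intro h t _ a b
    have htr : ∀ m : ℕ, ∀ a b : A, Lpow m (a * b) = Lpow m (b * a) := by
      intro m
      induction m with
      | zero => intro a b; simp [hL0, mul_comm]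
      | succ m ih => rw [hLsucc m]; exact convolution_mul_comm h ih
    simp only [htr _ a b]
end

section
/- Let A be a unital *-algebra over ℂ, ε : A → ℂ a unital *-homomorphism, h a complex Hilbert space, ρ : A → B(h) a unital ℂ-algebra homomorphism, η : A → h a (ρ,ε)-cocycle, and L : A → ℂ a ℂ-linear functional with L(1) = 0 satisfying the Schürmann-triple identity L(ab) = ⟨η(a*), η(b)⟩ + ε(a)L(b) + L(a)ε(b) for all a,b ∈ A. Let D denote the closure in h of the subspace η(A). Then L is tracial (L(ab) = L(ba) for all a,b ∈ A) if and only if there exists an anti-unitary operator J : D → D (a conjugate-linear bijective isometry) such that η(a*) = J(η(a)) for all a ∈ A. -/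
open scoped ComplexInnerProductSpace

namespace LinearIsometryEquiv

/-- An anti-unitary operator reverses inner products. -/
theorem inner_map_map_conj {E F : Type*} [NormedAddCommGroup E] [InnerProductSpace ℂ E]
    [NormedAddCommGroup F] [InnerProductSpace ℂ F] (J : E ≃ₗᵢ⋆[ℂ] F) (x y : E) :
    ⟪J x, J y⟫ = ⟪y, x⟫ := by
  rw [inner_eq_sum_norm_sq_div_four (𝕜 := ℂ) (J x) (J y),
    inner_eq_sum_norm_sq_div_four (𝕜 := ℂ) y x]
  have h_add : ‖J x + J y‖ = ‖y + x‖ := by rw [← map_add, J.norm_map, add_comm]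
  have h_sub : ‖J x - J y‖ = ‖y - x‖ := by rw [← map_sub, J.norm_map, norm_sub_rev]
  have h_sub_I : ‖J x - (RCLike.I : ℂ) • J y‖ = ‖y - (RCLike.I : ℂ) • x‖ := by
    have h : J x - (RCLike.I : ℂ) • J y = J ((RCLike.I : ℂ) • (y - (RCLike.I : ℂ) • x)) := by
      simp [smul_smul, J.map_smulₛₗ, sub_eq_add_neg, add_comm]
    rw [h, J.norm_map, norm_smul]
    simp
  have h_add_I : ‖J x + (RCLike.I : ℂ) • J y‖ = ‖y + (RCLike.I : ℂ) • x‖ := by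
    have h : J x + (RCLike.I : ℂ) • J y = J (-(RCLike.I : ℂ) • (y + (RCLike.I : ℂ) • x)) := by
      simp [smul_add, smul_smul, J.map_smulₛₗ, add_comm]
    rw [h, J.norm_map, norm_smul]
    simp
  rw [h_add, h_sub, h_sub_I, h_add_I]

end LinearIsometryEquiv

/-- The commutator `L (a * b) - L (b * a)` depends on the cocycle alone, because the
character takes commuting values. -/
theorem tracial_iff_inner_eq {A H : Type*} [Mul A] [Star A]
    [NormedAddCommGroup H] [InnerProductSpace ℂ H] {ε L : A → ℂ} {η : A → H}
    (hL : ∀ a b : A, L (a * b) = ⟪η (star a), η b⟫ + ε a * L b + L a * ε b) :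
    (∀ a b : A, L (a * b) = L (b * a)) ↔
      ∀ a b : A, ⟪η (star a), η b⟫ = ⟪η (star b), η a⟫ := by
  refine forall₂_congr fun a b => ?_
  rw [hL, hL]
  constructor <;> intro h <;> linear_combination h

/-- For a Schürmann triple `(ρ, η, L)` on a unital *-algebra `A`, the generating
functional `L` is tracial iff there is an anti-unitary operator `J` on the closure `D` of
`η(A)` with `η(a*) = J (η a)` for all `a`. -/
theorem stmt_12 {A : Type*} [Ring A] [Algebra ℂ A] [StarRing A] [StarModule ℂ A]
    {H : Type*} [NormedAddCommGroup H] [InnerProductSpace ℂ H] [CompleteSpace H]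
    (ε : A →⋆ₐ[ℂ] ℂ)
    (ρ : A →ₐ[ℂ] (H →L[ℂ] H))
    (η : A →ₗ[ℂ] H)
    (hη : ∀ a b : A, η (a * b) = ρ a (η b) + ε b • η a)
    (L : A →ₗ[ℂ] ℂ)
    (hL1 : L 1 = 0)
    (hLmul : ∀ a b : A, L (a * b) = ⟪η (star a), η b⟫ + ε a * L b + L a * ε b) :
    (∀ a b : A, L (a * b) = L (b * a)) ↔
      ∃ J : ↥((LinearMap.range η).topologicalClosure) ≃ₗᵢ⋆[ℂ]
          ↥((LinearMap.range η).topologicalClosure),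
        ∀ a : A,
          (↑(J ⟨η a, Submodule.le_topologicalClosure _ (LinearMap.mem_range_self η a)⟩) : H) =
            η (star a) := by
  rw [tracial_iff_inner_eq hLmul]
  constructor
  · intro h
    let e : A →ₗ[ℂ] (LinearMap.range η).topologicalClosure :=
      η.codRestrict _ fun a =>
        Submodule.le_topologicalClosure _ (LinearMap.mem_range_self η a)
    have he : DenseRange e := by
      intro x
      rw [closure_subtype, ← Set.range_comp]
      exact x.2
    have h_norm (a : A) : ‖e (starLinearEquiv ℂ a)‖ = ‖e a‖ := by
      have h_inner : ⟪η (star a), η (star a)⟫ = ⟪η a, η a⟫ := by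
        simpa using h a (star a)
      change ‖η (star a)‖ = ‖η a‖
      rw [norm_eq_sqrt_re_inner (𝕜 := ℂ), h_inner, ← norm_eq_sqrt_re_inner]
    exact ⟨(starLinearEquiv ℂ).extendOfIsometry e e he he h_norm, fun a =>
      congrArg Subtype.val (LinearEquiv.extendOfIsometry_eq _ e e he he h_norm a)⟩
  · rintro ⟨J, hJ⟩ a b
    have hJ' := hJ (star b)
    rw [star_star] at hJ'
    rw [← hJ a, ← hJ', ← Submodule.coe_inner, J.inner_map_map_conj, Submodule.coe_inner]
end

section
/- Let A be a unital *-algebra over ℂ, ε : A → ℂ a unital *-homomorphism, h a complex inner product space, η : A → h a ℂ-linear map satisfying the Gaussian (Leibniz) rule η(ab) = ε(a)η(b) + ε(b)η(a) for all a,b ∈ A, and L : A → ℂ a ℂ-linear functional with L(1) = 0 satisfying L(ab) = ⟨η(a*), η(b)⟩ + ε(a)L(b) + L(a)ε(b) for all a,b ∈ A. If L is tracial (L(ab) = L(ba) for all a,b ∈ A), then L vanishes on the two-sided ideal of A generated by all commutators; in particular L(a(bc − cb)d) = 0 for all a,b,c,d ∈ A. -/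
open scoped ComplexInnerProductSpace

/-- A tracial Gaussian generating functional (i.e. the cocycle `η` satisfies the
Leibniz rule) vanishes on the two-sided ideal generated by all commutators; in particular
`L (a (bc - cb) d) = 0`. -/
theorem stmt_14 {A : Type*} [Ring A] [Algebra ℂ A] [StarRing A] [StarModule ℂ A]
    {H : Type*} [NormedAddCommGroup H] [InnerProductSpace ℂ H]
    (ε : A →⋆ₐ[ℂ] ℂ)
    (η : A →ₗ[ℂ] H)
    (hη : ∀ a b : A, η (a * b) = ε a • η b + ε b • η a)
    (L : A →ₗ[ℂ] ℂ)
    (hL1 : L 1 = 0)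
    (hLmul : ∀ a b : A, L (a * b) = ⟪η (star a), η b⟫ + ε a * L b + L a * ε b)
    (htrace : ∀ a b : A, L (a * b) = L (b * a)) :
    (∀ x ∈ TwoSidedIdeal.span {y : A | ∃ a b : A, y = a * b - b * a}, L x = 0) ∧
      ∀ a b c d : A, L (a * (b * c - c * b) * d) = 0 := by
  have hmul : ∀ x y : A, L y = 0 → η y = 0 → ε y = 0 → L (x * y) = 0 := by
    intro x y hL he hε
    simp [hLmul, hL, he, hε]
  let K : TwoSidedIdeal A := TwoSidedIdeal.mk' {y : A | L y = 0 ∧ η y = 0 ∧ ε y = 0}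
    (by simp)
    (by
      rintro x y ⟨h₁, h₂, h₃⟩ ⟨k₁, k₂, k₃⟩
      simp [h₁, h₂, h₃, k₁, k₂, k₃])
    (by
      rintro x ⟨h₁, h₂, h₃⟩
      simp [h₁, h₂, h₃])
    (by
      rintro x y ⟨h₁, h₂, h₃⟩
      exact ⟨hmul x y h₁ h₂ h₃, by simp [hη, h₂, h₃], by simp [h₃]⟩)
    (by
      rintro x y ⟨h₁, h₂, h₃⟩
      exact ⟨by rw [htrace, hmul y x h₁ h₂ h₃], by simp [hη, h₂, h₃], by simp [h₃]⟩)
  have hK : ∀ x, x ∈ K ↔ L x = 0 ∧ η x = 0 ∧ ε x = 0 := fun x => by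
    simp only [K, TwoSidedIdeal.mem_mk', Set.mem_ofPred_eq]
  have hcK : ∀ a b : A, a * b - b * a ∈ K := fun a b => by
    rw [hK]
    refine ⟨by rw [map_sub, htrace, sub_self], ?_, by simp [mul_comm]⟩
    rw [map_sub, hη, hη, add_comm, sub_self]
  refine ⟨fun x hx => ?_, fun a b c d => ?_⟩
  · refine ((hK x).1 (TwoSidedIdeal.mem_span_iff.1 hx K ?_)).1
    rintro _ ⟨a, b, rfl⟩
    exact hcK a b
  · exact ((hK _).1 (K.mul_mem_right _ _ (K.mul_mem_left _ _ (hcK b c)))).1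
end

section
/- Let A be a unital C*-algebra, ε : A → ℂ a character (a unital *-homomorphism), and L : A → ℂ a bounded ℂ-linear functional such that L(1) = 0, L(a*) = conj(L(a)) for all a ∈ A, and L(a*a) ≥ 0 for every a ∈ A with ε(a) = 0. Then L is of Poisson type: there exist a real number λ ≥ 0 and a state ω on A (a positive ℂ-linear functional with ω(1) = 1) such that L = λ(ω − ε). -/
open scoped ComplexOrder

/-- A character kernel contains, for each of its elements `k`, a selfadjoint contraction acting
almost as a left unit on `k`. -/
theorem exists_selfAdjoint_contraction_mem_ker_norm_sub_mul_le {A : Type*} [CStarAlgebra A]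
    (ε : A →⋆ₐ[ℂ] ℂ) {k : A} (hk : ε k = 0) {η : ℝ} (hη : 0 < η) :
    ∃ e : A, IsSelfAdjoint e ∧ ‖e‖ ≤ 1 ∧ ε e = 0 ∧ ‖k - e * k‖ ≤ η := by
  set f : ℝ → ℝ := fun t => min 1 (|t| / η ^ 2) with hf
  have hfc : Continuous f := by fun_prop
  have hf0 : ∀ t, 0 ≤ f t := fun t => by positivity
  have hf1 : ∀ t, f t ≤ 1 := fun t => min_le_left _ _
  have hh : IsSelfAdjoint (k * star k) := IsSelfAdjoint.mul_star_self k
  have he : IsSelfAdjoint (cfc f (k * star k)) := cfc_predicate f _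
  refine ⟨cfc f (k * star k), he, ?_, ?_, ?_⟩
  · refine norm_cfc_le zero_le_one fun t _ => ?_
    rw [Real.norm_of_nonneg (hf0 t)]
    exact hf1 t
  · have hε : ε (k * star k) = 0 := by simp [hk]
    have hcont : Continuous ε := map_continuous ε
    have hmap := StarAlgHomClass.map_cfc (R := ℝ) (S := ℂ) ε f (k * star k)
      hfc.continuousOn hcont hh (hh.map ε)
    rw [hmap, hε, cfc_apply_zero]
    simp [hf]
  · have hg : (k - cfc f (k * star k) * k) * star (k - cfc f (k * star k) * k)
        = cfc (fun t => (1 - f t) * t * (1 - f t)) (k * star k) := by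
      have h1 : cfc (fun t => 1 - f t) (k * star k) = 1 - cfc f (k * star k) := by
        rw [cfc_sub (fun _ => (1 : ℝ)) f (k * star k) (by fun_prop) hfc.continuousOn,
          cfc_const_one ℝ (k * star k)]
      rw [cfc_mul (fun t => (1 - f t) * t) (fun t => 1 - f t) (k * star k)
          (by fun_prop) (by fun_prop),
        cfc_mul (fun t => 1 - f t) (fun t => t) (k * star k) (by fun_prop) (by fun_prop),
        h1, cfc_id' ℝ (k * star k), star_sub, star_mul, he.star_eq]
      noncomm_ring
    have hn : ‖k - cfc f (k * star k) * k‖ * ‖k - cfc f (k * star k) * k‖ ≤ η ^ 2 := by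
      rw [← CStarRing.norm_self_mul_star, hg]
      refine norm_cfc_le (by positivity) fun t _ => ?_
      have h0 := hf0 t
      have h1 := hf1 t
      rw [Real.norm_eq_abs, abs_mul, abs_mul, abs_of_nonneg (sub_nonneg.2 h1)]
      rcases le_total (η ^ 2) |t| with ht | ht
      · have : f t = 1 := min_eq_left ((one_le_div (by positivity)).2 ht)
        rw [this]
        simp only [sub_self, zero_mul, mul_zero]
        positivity
      · calc (1 - f t) * |t| * (1 - f t) ≤ 1 * |t| * 1 := by gcongr <;> linarith
          _ ≤ η ^ 2 := by linarith
    exact abs_le_of_sq_le_sq' (by rwa [← sq] at hn) hη.le |>.2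

/-- A bounded hermitian functional that vanishes at `1` and is positive on the kernel of the
character `ε` becomes positive on the whole algebra after adding `‖L‖ • ε`. -/
theorem re_star_mul_self_add_opNorm_mul_normSq_nonneg {A : Type*} [CStarAlgebra A]
    (ε : A →⋆ₐ[ℂ] ℂ) (L : A →L[ℂ] ℂ) (hL1 : L 1 = 0)
    (hLstar : ∀ a : A, L (star a) = (starRingEnd ℂ) (L a))
    (hLpos : ∀ a : A, ε a = 0 → 0 ≤ L (star a * a)) (a : A) :
    0 ≤ (L (star a * a)).re + ‖L‖ * ‖ε a‖ ^ 2 := by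
  set c := ε a with hc
  set k := a - algebraMap ℂ A c with hkdef
  have hk : ε k = 0 := by simp [hkdef, AlgHomClass.commutes, hc]
  have key : ∀ η : ℝ, 0 < η →
      -(2 * ‖c‖ * ‖L‖ * η) ≤ (L (star a * a)).re + ‖L‖ * ‖c‖ ^ 2 := by
    intro η hη
    obtain ⟨e, he, hen, hεe, hke⟩ :=
      exists_selfAdjoint_contraction_mem_ker_norm_sub_mul_le ε hk hη
    have hb := hLpos (k + c • e) (by simp [hk, hεe])
    have hdec : star a * a = star (k + c • e) * (k + c • e)
        + (star c • (k - e * k) + star (star c • (k - e * k)))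
        + (star c * c) • (1 - e * e) := by
      have ha : a = k + c • (1 : A) := by simp [hkdef, Algebra.algebraMap_eq_smul_one]
      rw [ha]
      simp only [star_add, star_smul, star_sub, star_mul, he.star_eq, star_one, add_mul, mul_add,
        smul_mul_assoc, mul_smul_comm, star_star, smul_sub, mul_one, one_mul,
        smul_add, mul_comm (star c) c, mul_smul]
      abel
    have hcc : star c * c = ((‖c‖ ^ 2 : ℝ) : ℂ) := by
      simpa using Complex.conj_mul' c
    have hLee : (L (e * e)).re ≤ ‖L‖ := by
      calc (L (e * e)).re ≤ ‖L (e * e)‖ := Complex.re_le_norm _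
        _ ≤ ‖L‖ * ‖e * e‖ := L.le_opNorm _
        _ ≤ ‖L‖ * 1 := by
            gcongr
            exact (norm_mul_le e e).trans (mul_le_one₀ hen (norm_nonneg e) hen)
        _ = ‖L‖ := mul_one _
    have hcross : |(L (star c • (k - e * k))).re| ≤ ‖c‖ * ‖L‖ * η := by
      calc |(L (star c • (k - e * k))).re| ≤ ‖L (star c • (k - e * k))‖ := Complex.abs_re_le_norm _
        _ = ‖c‖ * ‖L (k - e * k)‖ := by rw [map_smul, norm_smul, norm_star]
        _ ≤ ‖c‖ * (‖L‖ * η) := by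
            gcongr
            exact (L.le_opNorm _).trans (by gcongr)
        _ = ‖c‖ * ‖L‖ * η := by ring
    have hre := (Complex.le_def.1 hb).1
    rw [Complex.zero_re] at hre
    rw [hdec, map_add, map_add, map_add, hLstar, map_smul L (star c * c), map_sub, hL1, hcc]
    simp only [Complex.add_re, Complex.conj_re, smul_eq_mul, Complex.re_ofReal_mul, zero_sub,
      Complex.neg_re]
    have := mul_le_mul_of_nonneg_left hLee (sq_nonneg ‖c‖)
    linarith [(abs_le.1 hcross).1]
  by_contra! hneg
  set x := (L (star a * a)).re + ‖L‖ * ‖c‖ ^ 2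
  have hM : 0 ≤ 2 * ‖c‖ * ‖L‖ := by positivity
  have h := key (-x / (2 * (2 * ‖c‖ * ‖L‖ + 1))) (div_pos (by linarith) (by linarith))
  have h' : 2 * ‖c‖ * ‖L‖ * (-x / (2 * (2 * ‖c‖ * ‖L‖ + 1))) ≤ -x / 2 := by
    rw [mul_div_assoc', div_le_div_iff₀ (by linarith) two_pos]
    nlinarith
  linarith

/-- A bounded generating functional on a unital C*-algebra with a character `ε`
(vanishing at 1, hermitian, positive on the kernel of `ε`) is of Poisson type:
`L = λ(ω - ε)` for some `λ ≥ 0` and a state `ω`. -/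
theorem stmt_16 {A : Type*} [NormedRing A] [StarRing A] [CStarRing A] [NormedAlgebra ℂ A]
    [StarModule ℂ A] [CompleteSpace A]
    (ε : A →⋆ₐ[ℂ] ℂ)
    (L : A →L[ℂ] ℂ)
    (hL1 : L 1 = 0)
    (hLstar : ∀ a : A, L (star a) = (starRingEnd ℂ) (L a))
    (hLpos : ∀ a : A, ε a = 0 → 0 ≤ L (star a * a)) :
    ∃ (lam : ℝ) (ω : A →ₗ[ℂ] ℂ), 0 ≤ lam ∧ ω 1 = 1 ∧ (∀ a : A, 0 ≤ ω (star a * a)) ∧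
      ∀ a : A, L a = (lam : ℂ) * (ω a - ε a) := by
  let _ : CStarAlgebra A := {}
  have hpos : 0 < ‖L‖ + 1 := by positivity
  have hne : ((‖L‖ + 1 : ℝ) : ℂ) ≠ 0 := Complex.ofReal_ne_zero.2 hpos.ne'
  refine ⟨‖L‖ + 1, (((‖L‖ + 1)⁻¹ : ℝ) : ℂ) • (L : A →ₗ[ℂ] ℂ) + (ε : A →ₐ[ℂ] ℂ).toLinearMap,
    hpos.le, by simp [hL1], fun a => ?_, fun a => ?_⟩
  · have hreal : (starRingEnd ℂ) (L (star a * a)) = L (star a * a) := by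
      rw [← hLstar, star_mul, star_star]
    obtain ⟨r, hr⟩ := Complex.conj_eq_iff_real.1 hreal
    have hmain := re_star_mul_self_add_opNorm_mul_normSq_nonneg ε L hL1 hLstar hLpos a
    rw [hr, Complex.ofReal_re] at hmain
    have hεa : ε (star a * a) = ((‖ε a‖ ^ 2 : ℝ) : ℂ) := by
      rw [map_mul, map_star]
      simpa using Complex.conj_mul' (ε a)
    have hω : 0 ≤ (‖L‖ + 1)⁻¹ * r + ‖ε a‖ ^ 2 := by
      have : (‖L‖ + 1)⁻¹ * r + ‖ε a‖ ^ 2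
          = (‖L‖ + 1)⁻¹ * ((r + ‖L‖ * ‖ε a‖ ^ 2) + ‖ε a‖ ^ 2) := by
        field_simp
        ring
      rw [this]
      positivity
    have heq : ((((‖L‖ + 1)⁻¹ : ℝ) : ℂ) • (L : A →ₗ[ℂ] ℂ) + (ε : A →ₐ[ℂ] ℂ).toLinearMap)
        (star a * a) = (((‖L‖ + 1)⁻¹ * r + ‖ε a‖ ^ 2 : ℝ) : ℂ) := by
      change (((‖L‖ + 1)⁻¹ : ℝ) : ℂ) * L (star a * a) + ε (star a * a) = _
      rw [hr, hεa]
      push_cast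
      ring
    rw [heq]
    exact Complex.zero_le_real.2 hω
  · change L a = ((‖L‖ + 1 : ℝ) : ℂ) * ((((‖L‖ + 1)⁻¹ : ℝ) : ℂ) * L a + ε a - ε a)
    rw [add_sub_cancel_right, Complex.ofReal_inv, mul_inv_cancel_left₀ hne]
end

section
/- Let A be a Hopf algebra over ℂ with counit ε and antipode S which is also a *-algebra, generated as a ℂ-algebra by a 4×4 magic unitary (p_{ij})_{i,j=1,…,4} with p_{ij}* = p_{ij}, ε(p_{ij}) = δ_{ij} and S(p_{ij}) = p_{ji}. Let P, Q be orthogonal projections on a complex Hilbert space h and let ρ : A → B(h) be a unital ℂ-algebra homomorphism with ρ(p_{11}) = ρ(p_{22}) = P, ρ(p_{12}) = ρ(p_{21}) = 1−P, ρ(p_{33}) = ρ(p_{44}) = Q, ρ(p_{34}) = ρ(p_{43}) = 1−Q, and ρ(p_{ij}) = 0 for all other pairs (i,j). Let η : A → h be a (ρ,ε)-cocycle, set ξ = η(p_{11}) and ζ = η(p_{33}) (so that automatically Pξ = 0 and Qζ = 0), and let L : A → ℂ be a ℂ-linear functional with L(1) = 0 satisfying the Schürmann-triple identity L(ab) = ⟨η(a*),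 η(b)⟩ + ε(a)L(b) + L(a)ε(b) for all a,b ∈ A. Then L is invariant under the antipode, L ∘ S = L, if and only if ⟨ζ, (PQ)^k ξ⟩ = ⟨(PQ)^k ξ, ζ⟩ for every integer k ≥ 0. -/
open scoped ComplexInnerProductSpace

section Words

variable {A : Type*} [Ring A] [HopfAlgebra ℂ A] [StarRing A]
  {H : Type*} [NormedAddCommGroup H] [InnerProductSpace ℂ H]

/-- On words in self-adjoint generators, if `ρ`, `η` and the counit do not distinguish a generator
from its antipode, then they do not distinguish the antipode of a word from its adjoint. -/
lemma antipode_eq_star_on_words (G : Set A) (ρ : A →ₐ[ℂ] (H →L[ℂ] H)) (η : A →ₗ[ℂ] H)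
    (hη : ∀ a b : A, η (a * b) = ρ a (η b) + Coalgebra.counit (R := ℂ) b • η a)
    (hsa : ∀ g ∈ G, star g = g)
    (hSG : ∀ g ∈ G, HopfAlgebra.antipode (R := ℂ) g ∈ G)
    (hSρ : ∀ g ∈ G, ρ (HopfAlgebra.antipode (R := ℂ) g) = ρ g)
    (hSη : ∀ g ∈ G, η (HopfAlgebra.antipode (R := ℂ) g) = η g)
    {w : A} (hw : w ∈ Submonoid.closure G) :
    (ρ (HopfAlgebra.antipode (R := ℂ) w) = ρ (star w) ∧
      η (HopfAlgebra.antipode (R := ℂ) w) = η (star w)) ∧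
    (ρ (star (HopfAlgebra.antipode (R := ℂ) w)) = ρ w ∧
      η (star (HopfAlgebra.antipode (R := ℂ) w)) = η w ∧
      Coalgebra.counit (R := ℂ) (star (HopfAlgebra.antipode (R := ℂ) w)) =
        Coalgebra.counit (R := ℂ) w) ∧
    star w ∈ Submonoid.closure G := by
  induction hw using Submonoid.closure_induction_left with
  | one => simp [HopfAlgebra.antipode_one]
  | mul_left g hg w hw ih =>
    obtain ⟨⟨h1, h2⟩, ⟨h3, h4, h5⟩, h6⟩ := ih
    have hs := hsa _ (hSG g hg)
    refine ⟨⟨?_, ?_⟩, ⟨?_, ?_, ?_⟩, ?_⟩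
    · simp [HopfAlgebra.antipode_mul_antidistrib, h1, hSρ g hg, hsa g hg]
    · simp [HopfAlgebra.antipode_mul_antidistrib, h1, h2, hη, hSη g hg, hsa g hg]
    · simp [HopfAlgebra.antipode_mul_antidistrib, h3, hSρ g hg, hs]
    · simp [HopfAlgebra.antipode_mul_antidistrib, hη, h4, h5, hSρ g hg, hSη g hg, hs]
    · simp [HopfAlgebra.antipode_mul_antidistrib, h5, hs]
    · rw [star_mul, hsa g hg]
      exact mul_mem h6 (Submonoid.subset_closure hg)

/-- A generating functional of a Schürmann triple is antipode-invariant iff all inner products of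
the cocycle on words in the generators are symmetric. -/
lemma antipode_invariant_iff_inner_words_comm (G : Set A)
    (hgen : Algebra.adjoin ℂ G = ⊤)
    (ρ : A →ₐ[ℂ] (H →L[ℂ] H)) (η : A →ₗ[ℂ] H)
    (hη : ∀ a b : A, η (a * b) = ρ a (η b) + Coalgebra.counit (R := ℂ) b • η a)
    (hsa : ∀ g ∈ G, star g = g)
    (hSG : ∀ g ∈ G, HopfAlgebra.antipode (R := ℂ) g ∈ G)
    (hSρ : ∀ g ∈ G, ρ (HopfAlgebra.antipode (R := ℂ) g) = ρ g)
    (hSη : ∀ g ∈ G, η (HopfAlgebra.antipode (R := ℂ) g) = η g)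
    (L : A →ₗ[ℂ] ℂ) (hSL : ∀ g ∈ G, L (HopfAlgebra.antipode (R := ℂ) g) = L g)
    (hLmul : ∀ a b : A, L (a * b) = ⟪η (star a), η b⟫ +
      Coalgebra.counit (R := ℂ) a * L b + L a * Coalgebra.counit (R := ℂ) b) :
    (∀ a : A, L (HopfAlgebra.antipode (R := ℂ) a) = L a) ↔
      ∀ x ∈ Submonoid.closure G, ∀ y ∈ Submonoid.closure G, ⟪η x, η y⟫ = ⟪η y, η x⟫ := by
  have key := fun w (hw : w ∈ Submonoid.closure G) ↦
    antipode_eq_star_on_words G ρ η hη hsa hSG hSρ hSη hw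
  constructor
  · intro h x hx y hy
    obtain ⟨-, -, hx'⟩ := key x hx
    obtain ⟨⟨-, h1⟩, -⟩ := key _ hx'
    obtain ⟨-, ⟨-, h2, -⟩, -⟩ := key y hy
    have := h (star x * y)
    rw [HopfAlgebra.antipode_mul_antidistrib, hLmul, hLmul, h, h, h1, h2] at this
    simp only [star_star, HopfAlgebra.counit_antipode] at this
    linear_combination -this
  · intro h a
    have hw : ∀ w ∈ Submonoid.closure G, L (HopfAlgebra.antipode (R := ℂ) w) = L w := by
      intro w hw
      induction hw using Submonoid.closure_induction_left with
      | one => simp [HopfAlgebra.antipode_one]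
      | mul_left g hg w hw ih =>
        obtain ⟨-, ⟨-, h2, -⟩, -⟩ := key w hw
        rw [HopfAlgebra.antipode_mul_antidistrib, hLmul, hLmul, ih, h2, hSL g hg, hSη g hg,
          hsa g hg, h w hw g (Submonoid.subset_closure hg)]
        simp only [HopfAlgebra.counit_antipode]
        ring
    have ha : a ∈ Submodule.span ℂ (Submonoid.closure G : Set A) := by
      rw [← Algebra.adjoin_eq_span, hgen]
      trivial
    induction ha using Submodule.span_induction with
    | mem x hx => exact hw x hx
    | zero => simp
    | add x y _ _ hx hy => simp [hx, hy]
    | smul c x _ hx => simp [hx]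

end Words

section Projections

variable {H : Type*} [NormedAddCommGroup H] [InnerProductSpace ℂ H]

/-- The additive subgroup of vectors whose inner product with `z` is symmetric. -/
def innerCommSubgroup (z : H) : AddSubgroup H where
  carrier := {x | ⟪z, x⟫ = ⟪x, z⟫}
  zero_mem' := by simp
  add_mem' := by
    intro a b ha hb
    simp only [Set.mem_ofPred_eq] at *
    rw [inner_add_left, inner_add_right, ha, hb]
  neg_mem' := by
    intro a ha
    simp only [Set.mem_ofPred_eq] at *
    rw [inner_neg_left, inner_neg_right, ha]

lemma mem_innerCommSubgroup {z x : H} : x ∈ innerCommSubgroup z ↔ ⟪z, x⟫ = ⟪x, z⟫ := Iff.rfl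

/-- Alternating words in `P` and `Q` applied to `ξ` and `ζ`. -/
def alternatingVectors (P Q : H →L[ℂ] H) (ξ ζ : H) : Set H :=
  {x | ∃ k : ℕ, x = ((P * Q) ^ k) ξ ∨ x = (Q * (P * Q) ^ k) ξ ∨
    x = ((Q * P) ^ k) ζ ∨ x = (P * (Q * P) ^ k) ζ}

lemma alternatingVectors_swap (P Q : H →L[ℂ] H) (ξ ζ : H) :
    alternatingVectors Q P ζ ξ = alternatingVectors P Q ξ ζ := by
  ext x
  simp only [alternatingVectors, Set.mem_ofPred_eq]
  exact exists_congr fun k ↦ by tauto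

/-- The additive subgroup spanned by the alternating words in `P`, `Q` applied to `ξ`, `ζ`. -/
def alternatingSubgroup (P Q : H →L[ℂ] H) (ξ ζ : H) : AddSubgroup H :=
  AddSubgroup.closure (alternatingVectors P Q ξ ζ)

lemma alternatingSubgroup_swap (P Q : H →L[ℂ] H) (ξ ζ : H) :
    alternatingSubgroup Q P ζ ξ = alternatingSubgroup P Q ξ ζ := by
  rw [alternatingSubgroup, alternatingVectors_swap, alternatingSubgroup]

lemma left_mem_alternatingSubgroup (P Q : H →L[ℂ] H) (ξ ζ : H) :
    ξ ∈ alternatingSubgroup P Q ξ ζ :=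
  AddSubgroup.subset_closure ⟨0, Or.inl (by simp)⟩

lemma map_mem_alternatingSubgroup {P Q : H →L[ℂ] H} {ξ ζ : H} (hP : IsIdempotentElem P)
    (hξ : P ξ = 0) {x : H} (hx : x ∈ alternatingSubgroup P Q ξ ζ) :
    P x ∈ alternatingSubgroup P Q ξ ζ := by
  have hPP : ∀ y, P (P y) = P y := fun y ↦ DFunLike.congr_fun hP y
  refine AddSubgroup.closure_induction (p := fun x _ ↦ P x ∈ alternatingSubgroup P Q ξ ζ)
    ?_ (by simp) (fun x y _ _ hx hy ↦ by simpa using add_mem hx hy)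
    (fun x _ hx ↦ by simpa using hx) hx
  rintro x ⟨k, rfl | rfl | rfl | rfl⟩
  · cases k with
    | zero => simp [hξ]
    | succ k =>
      refine AddSubgroup.subset_closure ⟨k + 1, Or.inl ?_⟩
      simp [pow_succ', hPP]
  · refine AddSubgroup.subset_closure ⟨k + 1, Or.inl ?_⟩
    simp [pow_succ']
  · exact AddSubgroup.subset_closure ⟨k, Or.inr (Or.inr (Or.inr (by simp)))⟩
  · refine AddSubgroup.subset_closure ⟨k, Or.inr (Or.inr (Or.inr ?_))⟩
    simp [hPP]

variable [CompleteSpace H]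

lemma IsSelfAdjoint.inner_apply_left {T : H →L[ℂ] H} (hT : IsSelfAdjoint T) (x y : H) :
    ⟪T x, y⟫ = ⟪x, T y⟫ :=
  hT.isSymmetric x y

lemma alternatingSubgroup_le_innerCommSubgroup {P Q : H →L[ℂ] H} {ξ ζ : H}
    (hPsa : IsSelfAdjoint P) (hQsa : IsSelfAdjoint Q) (hξ : P ξ = 0)
    (h : ∀ k : ℕ, ⟪ξ, ((Q * P) ^ k) ζ⟫ = ⟪((Q * P) ^ k) ζ, ξ⟫) :
    alternatingSubgroup P Q ξ ζ ≤ innerCommSubgroup ξ := by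
  have hPl : ∀ y, ⟪P y, ξ⟫ = 0 := fun y ↦ by rw [hPsa.inner_apply_left, hξ, inner_zero_right]
  have hPr : ∀ y, ⟪ξ, P y⟫ = 0 := fun y ↦ by rw [← hPsa.inner_apply_left, hξ, inner_zero_left]
  refine (AddSubgroup.closure_le _).2 ?_
  rintro x ⟨k, rfl | rfl | rfl | rfl⟩ <;> rw [SetLike.mem_coe, mem_innerCommSubgroup]
  · cases k with
    | zero => simp
    | succ k => simp [pow_succ', hPl, hPr]
  · refine (IsSelfAdjoint.inner_apply_left ?_ ξ ξ).symm
    rw [IsSelfAdjoint, star_mul, star_pow, star_mul, hPsa.star_eq, hQsa.star_eq]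
    exact ((SemiconjBy.pow_right (by simp [SemiconjBy, mul_assoc]) k : SemiconjBy Q _ _).eq).symm
  · exact h k
  · simp [hPl, hPr]

lemma inner_comm_of_mem_alternatingSubgroup {P Q : H →L[ℂ] H} {ξ ζ : H}
    (hP : IsIdempotentElem P) (hPsa : IsSelfAdjoint P)
    (hQ : IsIdempotentElem Q) (hQsa : IsSelfAdjoint Q) (hξ : P ξ = 0) (hζ : Q ζ = 0)
    (h : ∀ k : ℕ, ⟪ζ, ((P * Q) ^ k) ξ⟫ = ⟪((P * Q) ^ k) ξ, ζ⟫) {x y : H}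
    (hx : x ∈ alternatingSubgroup P Q ξ ζ) (hy : y ∈ alternatingSubgroup P Q ξ ζ) :
    ⟪x, y⟫ = ⟪y, x⟫ := by
  have hadj : ∀ k : ℕ, ∀ u v : H, ⟪((P * Q) ^ k) u, v⟫ = ⟪u, ((Q * P) ^ k) v⟫ := fun k u v ↦ by
    rw [← ContinuousLinearMap.adjoint_inner_right, ← ContinuousLinearMap.star_eq_adjoint,
      star_pow, star_mul, hPsa.star_eq, hQsa.star_eq]
  have hadj' : ∀ k : ℕ, ∀ u v : H, ⟪u, ((P * Q) ^ k) v⟫ = ⟪((Q * P) ^ k) u, v⟫ := fun k u v ↦ by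
    rw [← inner_conj_symm, hadj, inner_conj_symm]
  have hPV : ∀ z ∈ alternatingSubgroup P Q ξ ζ, P z ∈ alternatingSubgroup P Q ξ ζ :=
    fun z ↦ map_mem_alternatingSubgroup hP hξ
  have hQV : ∀ z ∈ alternatingSubgroup P Q ξ ζ, Q z ∈ alternatingSubgroup P Q ξ ζ := by
    rw [← alternatingSubgroup_swap]
    exact fun z ↦ map_mem_alternatingSubgroup hQ hζ
  let U : AddSubgroup H := ⨅ z ∈ alternatingSubgroup P Q ξ ζ, innerCommSubgroup z
  have memU : ∀ u, u ∈ U ↔ ∀ z ∈ alternatingSubgroup P Q ξ ζ, ⟪z, u⟫ = ⟪u, z⟫ := by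
    intro u
    simp only [U, AddSubgroup.mem_iInf, mem_innerCommSubgroup]
  have hUξ : ξ ∈ U := (memU ξ).2 fun z hz ↦
    (mem_innerCommSubgroup.1 (alternatingSubgroup_le_innerCommSubgroup hPsa hQsa hξ
      (fun k ↦ by rw [← hadj, ← hadj', h]) hz)).symm
  have hUζ : ζ ∈ U := (memU ζ).2 fun z hz ↦
    (mem_innerCommSubgroup.1 (alternatingSubgroup_le_innerCommSubgroup hQsa hPsa hζ h
      (alternatingSubgroup_swap P Q ξ ζ ▸ hz))).symm
  have hUP : ∀ u ∈ U, P u ∈ U := fun u hu ↦ (memU _).2 fun z hz ↦ by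
    rw [← hPsa.inner_apply_left, hPsa.inner_apply_left u]
    exact (memU u).1 hu _ (hPV z hz)
  have hUQ : ∀ u ∈ U, Q u ∈ U := fun u hu ↦ (memU _).2 fun z hz ↦ by
    rw [← hQsa.inner_apply_left, hQsa.inner_apply_left u]
    exact (memU u).1 hu _ (hQV z hz)
  have hPQ : ∀ k : ℕ, ((P * Q) ^ k) ξ ∈ U := fun k ↦ by
    induction k with
    | zero => simpa using hUξ
    | succ k ih => simpa [pow_succ'] using hUP _ (hUQ _ ih)
  have hQP : ∀ k : ℕ, ((Q * P) ^ k) ζ ∈ U := fun k ↦ by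
    induction k with
    | zero => simpa using hUζ
    | succ k ih => simpa [pow_succ'] using hUQ _ (hUP _ ih)
  have hVU : alternatingSubgroup P Q ξ ζ ≤ U := by
    refine (AddSubgroup.closure_le _).2 ?_
    rintro x ⟨k, rfl | rfl | rfl | rfl⟩
    · exact hPQ k
    · exact hUQ _ (hPQ k)
    · exact hQP k
    · exact hUP _ (hQP k)
  exact (memU y).1 (hVU hy) x hx

end Projections

/-- For the two-block representation `ρ(P,Q)` of the 4×4 quantum permutation
group (a Hopf *-algebra generated by a magic unitary `p` with `S(p i j) = p j i`), a
generating functional `L` from a Schürmann triple `(ρ, η, L)` is antipode-invariant iff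
`⟪ζ, (PQ)^k ξ⟫ = ⟪(PQ)^k ξ, ζ⟫` for all `k ≥ 0`, where `ξ = η (p 1 1)`, `ζ = η (p 3 3)`. -/
theorem stmt_17 {A : Type*} [Ring A] [HopfAlgebra ℂ A] [StarRing A] [StarModule ℂ A]
    {H : Type*} [NormedAddCommGroup H] [InnerProductSpace ℂ H] [CompleteSpace H]
    (p : Fin 4 → Fin 4 → A)
    (hsa : ∀ i j, star (p i j) = p i j)
    (hidem : ∀ i j, p i j * p i j = p i j)
    (hrow0 : ∀ i j k, j ≠ k → p i j * p i k = 0)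
    (hcol0 : ∀ i j k, j ≠ k → p j i * p k i = 0)
    (hrow1 : ∀ i, ∑ j, p i j = 1)
    (hcol1 : ∀ i, ∑ j, p j i = 1)
    (hgen : Algebra.adjoin ℂ {a : A | ∃ i j, a = p i j} = ⊤)
    (hε : ∀ i j, Coalgebra.counit (R := ℂ) (p i j) = if i = j then (1 : ℂ) else 0)
    (hS : ∀ i j, HopfAlgebra.antipode (R := ℂ) (p i j) = p j i)
    (P Q : H →L[ℂ] H)
    (hPidem : IsIdempotentElem P) (hPsa : IsSelfAdjoint P)
    (hQidem : IsIdempotentElem Q) (hQsa : IsSelfAdjoint Q)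
    (ρ : A →ₐ[ℂ] (H →L[ℂ] H))
    (hρ00 : ρ (p 0 0) = P) (hρ11 : ρ (p 1 1) = P)
    (hρ01 : ρ (p 0 1) = 1 - P) (hρ10 : ρ (p 1 0) = 1 - P)
    (hρ22 : ρ (p 2 2) = Q) (hρ33 : ρ (p 3 3) = Q)
    (hρ23 : ρ (p 2 3) = 1 - Q) (hρ32 : ρ (p 3 2) = 1 - Q)
    (hρ0 : ∀ i j : Fin 4, ((i < 2 ∧ 2 ≤ j) ∨ (2 ≤ i ∧ j < 2)) → ρ (p i j) = 0)
    (η : A →ₗ[ℂ] H)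
    (hη : ∀ a b : A, η (a * b) = ρ a (η b) + Coalgebra.counit (R := ℂ) b • η a)
    (ξ ζ : H) (hξ : ξ = η (p 0 0)) (hζ : ζ = η (p 2 2))
    (L : A →ₗ[ℂ] ℂ)
    (hL1 : L 1 = 0)
    (hLmul : ∀ a b : A, L (a * b) = ⟪η (star a), η b⟫ +
      Coalgebra.counit (R := ℂ) a * L b + L a * Coalgebra.counit (R := ℂ) b) :
    (∀ a : A, L (HopfAlgebra.antipode (R := ℂ) a) = L a) ↔
      ∀ k : ℕ, ⟪ζ, ((P * Q) ^ k) ξ⟫ = ⟪((P * Q) ^ k) ξ, ζ⟫ := by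
  have hηg : ∀ i j, η (p i j) = ρ (p i j) (η (p i j)) + (if i = j then (1 : ℂ) else 0) • η (p i j) :=
    fun i j ↦ by rw [← hε, ← hη, hidem]
  have hηdiag : ∀ i, ρ (p i i) (η (p i i)) = 0 := fun i ↦ by simpa using hηg i i
  have hη0 : ∀ i j : Fin 4, ((i < 2 ∧ 2 ≤ j) ∨ (2 ≤ i ∧ j < 2)) → η (p i j) = 0 := fun i j hij ↦ by
    have hne : i ≠ j := by rintro rfl; omega
    simpa [hρ0 i j hij, hne] using hηg i j
  have hPξ : P ξ = 0 := by rw [hξ, ← hρ00]; exact hηdiag 0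
  have hQζ : Q ζ = 0 := by rw [hζ, ← hρ22]; exact hηdiag 2
  have hη1 : η 1 = 0 := by simpa using hη 1 1
  have hrow : ∀ i, η (p i 0) + η (p i 1) + η (p i 2) + η (p i 3) = 0 := fun i ↦ by
    rw [← hη1, ← hrow1 i, Fin.sum_univ_four, map_add, map_add, map_add]
  have hcol : ∀ i, η (p 0 i) + η (p 1 i) + η (p 2 i) + η (p 3 i) = 0 := fun i ↦ by
    rw [← hη1, ← hcol1 i, Fin.sum_univ_four, map_add, map_add, map_add]
  have hη01 : η (p 0 1) = -ξ := by
    have := hrow 0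
    rw [hη0 0 2 (by decide), hη0 0 3 (by decide), add_zero, add_zero, ← hξ] at this
    exact (neg_eq_of_add_eq_zero_right this).symm
  have hη10 : η (p 1 0) = -ξ := by
    have := hcol 0
    rw [hη0 2 0 (by decide), hη0 3 0 (by decide), add_zero, add_zero, ← hξ] at this
    exact (neg_eq_of_add_eq_zero_right this).symm
  have hη11 : η (p 1 1) = ξ := by
    have := hrow 1
    rw [hη0 1 2 (by decide), hη0 1 3 (by decide), add_zero, add_zero, hη10] at this
    exact (neg_add_eq_zero.1 this).symm
  have hη23 : η (p 2 3) = -ζ := by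
    have := hrow 2
    rw [hη0 2 0 (by decide), hη0 2 1 (by decide), add_zero, zero_add, ← hζ] at this
    exact (neg_eq_of_add_eq_zero_right this).symm
  have hη32 : η (p 3 2) = -ζ := by
    have := hcol 2
    rw [hη0 0 2 (by decide), hη0 1 2 (by decide), add_zero, zero_add, ← hζ] at this
    exact (neg_eq_of_add_eq_zero_right this).symm
  have hη33 : η (p 3 3) = ζ := by
    have := hrow 3
    rw [hη0 3 0 (by decide), hη0 3 1 (by decide), add_zero, zero_add, hη32] at this
    exact (neg_add_eq_zero.1 this).symm
  have hcases : ∀ i j, (ρ (p i j) = 0 ∨ ρ (p i j) = P ∨ ρ (p i j) = 1 - P ∨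
        ρ (p i j) = Q ∨ ρ (p i j) = 1 - Q) ∧
      (η (p i j) = 0 ∨ η (p i j) = ξ ∨ η (p i j) = -ξ ∨ η (p i j) = ζ ∨ η (p i j) = -ζ) ∧
      ρ (p j i) = ρ (p i j) ∧ η (p j i) = η (p i j) := by
    intro i j
    by_cases hij : (i < 2 ∧ 2 ≤ j) ∨ (2 ≤ i ∧ j < 2)
    · have hji : (j < 2 ∧ 2 ≤ i) ∨ (2 ≤ j ∧ i < 2) := by tauto
      simp [hρ0 i j hij, hη0 i j hij, hρ0 j i hji, hη0 j i hji]
    · fin_cases i <;> fin_cases j <;>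
        first
        | exact absurd (by decide) hij
        | simp [hρ00, hρ01, hρ10, hρ11, hρ22, hρ23, hρ32, hρ33, ← hξ, ← hζ, hη01, hη10, hη11,
            hη23, hη32, hη33]
  have hLoff : ∀ i j, i ≠ j → L (p i j) = ⟪η (p i j), η (p i j)⟫ := fun i j hij ↦ by
    have := hLmul (p i j) (p i j)
    simpa [hidem, hsa, hε, hij] using this
  have hSL : ∀ i j, L (p j i) = L (p i j) := fun i j ↦ by
    by_cases hij : i = j
    · rw [hij]
    · rw [hLoff i j hij, hLoff j i (Ne.symm hij), (hcases i j).2.2.2]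
  rw [antipode_invariant_iff_inner_words_comm {a : A | ∃ i j, a = p i j} hgen ρ η hη
    (by rintro _ ⟨i, j, rfl⟩; exact hsa i j)
    (by rintro _ ⟨i, j, rfl⟩; exact ⟨j, i, hS i j⟩)
    (by rintro _ ⟨i, j, rfl⟩; rw [hS]; exact (hcases i j).2.2.1)
    (by rintro _ ⟨i, j, rfl⟩; rw [hS]; exact (hcases i j).2.2.2)
    L (by rintro _ ⟨i, j, rfl⟩; rw [hS]; exact hSL i j) hLmul]
  set M := Submonoid.closure {a : A | ∃ i j, a = p i j} with hM
  have hpM : ∀ i j, p i j ∈ M := fun i j ↦ Submonoid.subset_closure ⟨i, j, rfl⟩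
  have hεM : ∀ w ∈ M, Coalgebra.counit (R := ℂ) w = 0 ∨ Coalgebra.counit (R := ℂ) w = 1 := by
    intro w hw
    induction hw using Submonoid.closure_induction_left with
    | one => simp
    | mul_left g hg w hw ih =>
      obtain ⟨i, j, rfl⟩ := hg
      rw [Bialgebra.counit_mul, hε]
      split_ifs <;> simp [ih]
  constructor
  · intro h
    let V := AddSubgroup.closure (η '' (M : Set A))
    have hηV : ∀ w ∈ M, η w ∈ V := fun w hw ↦ AddSubgroup.subset_closure ⟨w, hw, rfl⟩
    have hVρ : ∀ i j, ∀ x ∈ V, ρ (p i j) x ∈ V := by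
      intro i j x hx
      refine AddSubgroup.closure_induction (p := fun x _ ↦ ρ (p i j) x ∈ V)
        ?_ (by simp) (fun x y _ _ hx hy ↦ by simpa using add_mem hx hy)
        (fun x _ hx ↦ by simpa using hx) hx
      rintro _ ⟨w, hw, rfl⟩
      rw [eq_sub_of_add_eq (hη (p i j) w).symm]
      refine sub_mem (hηV _ (mul_mem (hpM i j) hw)) ?_
      rcases hεM w hw with h0 | h1
      · simp [h0]
      · simpa [h1] using hηV _ (hpM i j)
    have hξV : ∀ k : ℕ, ((P * Q) ^ k) ξ ∈ V := fun k ↦ by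
      induction k with
      | zero => simpa [hξ] using hηV _ (hpM 0 0)
      | succ k ih => simpa [pow_succ', hρ00, hρ22] using hVρ 0 0 _ (hVρ 2 2 _ ih)
    have hVcomm : ∀ w ∈ M, ∀ x ∈ V, ⟪η w, x⟫ = ⟪x, η w⟫ := by
      intro w hw
      refine (AddSubgroup.closure_le (innerCommSubgroup (η w))).2 ?_
      rintro _ ⟨v, hv, rfl⟩
      exact h w hw v hv
    intro k
    rw [hζ]
    exact hVcomm _ (hpM 2 2) _ (hξV k)
  · intro h
    have hξV := left_mem_alternatingSubgroup P Q ξ ζ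
    have hζV : ζ ∈ alternatingSubgroup P Q ξ ζ :=
      alternatingSubgroup_swap P Q ξ ζ ▸ left_mem_alternatingSubgroup Q P ζ ξ
    have hPV : ∀ x ∈ alternatingSubgroup P Q ξ ζ, P x ∈ alternatingSubgroup P Q ξ ζ :=
      fun x ↦ map_mem_alternatingSubgroup hPidem hPξ
    have hQV : ∀ x ∈ alternatingSubgroup P Q ξ ζ, Q x ∈ alternatingSubgroup P Q ξ ζ := by
      rw [← alternatingSubgroup_swap]
      exact fun x ↦ map_mem_alternatingSubgroup hQidem hQζ
    have hηV : ∀ w ∈ M, η w ∈ alternatingSubgroup P Q ξ ζ := by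
      intro w hw
      induction hw using Submonoid.closure_induction_left with
      | one => simp [hη1]
      | mul_left g hg w hw ih =>
        obtain ⟨i, j, rfl⟩ := hg
        obtain ⟨hρij, hηij, -⟩ := hcases i j
        rw [hη]
        refine add_mem ?_ ?_
        · rcases hρij with h | h | h | h | h <;> rw [h]
          · simp
          · exact hPV _ ih
          · exact sub_mem ih (hPV _ ih)
          · exact hQV _ ih
          · exact sub_mem ih (hQV _ ih)
        · have hmem : η (p i j) ∈ alternatingSubgroup P Q ξ ζ := by
            rcases hηij with h | h | h | h | h <;> rw [h]
            exacts [zero_mem _, hξV, neg_mem hξV, hζV, neg_mem hζV]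
          rcases hεM w hw with h0 | h1
          · simp [h0]
          · simpa [h1] using hmem
    exact fun x hx y hy ↦ inner_comm_of_mem_alternatingSubgroup hPidem hPsa hQidem hQsa hPξ hQζ h
      (hηV x hx) (hηV y hy)
end

section
/- Let G be a finite group with identity e, and let ν : G → ℝ satisfy ν(g) ≥ 0 for all g ≠ e and ∑_{g∈G} ν(g) = 0. Let S = {g ∈ G : g ≠ e and ν(g) > 0}. For f : G → ℂ define L(f) = ∑_{g∈G} f(g)ν(g) and η(f) ∈ ℂ^S by η(f)(g) = f(g) − f(e) for g ∈ S, and equip ℂ^S with the (semi-definite extended to definite on S) inner product ⟨ψ, φ⟩ = ∑_{g∈S} conj(ψ(g)) φ(g) ν(g), conjugate-linear in the first argument. Then for all f₁, f₂ : G → ℂ: ⟨η(f₁), η(f₂)⟩ = L(conj(f₁)·f₂) − conj(f₁(e))·L(f₂) − conj(L(f₁))·f₂(e), where conj(f₁)·f₂ is the pointwise product (conj(f₁))(g)·f₂(g) and conj(L(f₁)) = L(conj(f₁)). -/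
/-- For a finite group `G` and a measure `ν` with `ν(G) = 0` which is
nonnegative off the identity, the functional `L f = ∑ f(g) ν(g)` and the cocycle
`η f = (f - f(1))|_S` (with `S` the support of `ν` off the identity and the inner product
weighted by `ν`) satisfy the coboundary relation
`⟨η f₁, η f₂⟩ = L(conj f₁ · f₂) - conj(f₁ 1) L f₂ - conj(L f₁) f₂ 1`; moreover
`conj (L f) = L (conj f)`. -/
theorem stmt_19 {G : Type*} [Group G] [Fintype G] [DecidableEq G] (ν : G → ℝ)
    (hν : ∀ g : G, g ≠ 1 → 0 ≤ ν g)
    (hsum : ∑ g : G, ν g = 0)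
    (L : (G → ℂ) → ℂ)
    (hL : ∀ f : G → ℂ, L f = ∑ g : G, f g * (ν g : ℂ)) :
    (∀ f₁ f₂ : G → ℂ,
      (∑ g ∈ Finset.univ.filter (fun g : G => g ≠ 1 ∧ 0 < ν g),
        (starRingEnd ℂ) (f₁ g - f₁ 1) * (f₂ g - f₂ 1) * (ν g : ℂ)) =
      L (fun g => (starRingEnd ℂ) (f₁ g) * f₂ g)
        - (starRingEnd ℂ) (f₁ 1) * L f₂ - (starRingEnd ℂ) (L f₁) * f₂ 1) ∧
    ∀ f : G → ℂ, (starRingEnd ℂ) (L f) = L (fun g => (starRingEnd ℂ) (f g)) := by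
  have hconj : ∀ f : G → ℂ, (starRingEnd ℂ) (L f) = L (fun g => (starRingEnd ℂ) (f g)) := by
    intro f
    simp only [hL, map_sum, map_mul, Complex.conj_ofReal]
  refine ⟨fun f₁ f₂ => ?_, hconj⟩
  have hsumC : ∑ g : G, (ν g : ℂ) = 0 := by exact_mod_cast hsum
  have hsupport : ∀ g ∈ (Finset.univ : Finset G),
      (starRingEnd ℂ) (f₁ g - f₁ 1) * (f₂ g - f₂ 1) * (ν g : ℂ) ≠ 0 → g ≠ 1 ∧ 0 < ν g := by
    intro g _ hne
    have hg : g ≠ 1 := by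
      rintro rfl
      simp at hne
    refine ⟨hg, (hν g hg).lt_of_ne' ?_⟩
    intro h
    simp [h] at hne
  rw [Finset.sum_filter_of_ne hsupport, hconj, hL, hL, hL, Finset.mul_sum, Finset.sum_mul,
    ← Finset.sum_sub_distrib, ← Finset.sum_sub_distrib, ← sub_eq_zero, ← Finset.sum_sub_distrib]
  calc
    _ = ∑ g : G, (starRingEnd ℂ) (f₁ 1) * f₂ 1 * (ν g : ℂ) := by
      refine Finset.sum_congr rfl fun g _ => ?_
      rw [map_sub]
      ring
    _ = 0 := by rw [← Finset.mul_sum, hsumC, mul_zero]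
end
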